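/- The function λ is complex differentiable on the upper half-plane and satisfies dλ/dz (z) = −π·i·θ₂(z)⁴·λ(z) for every z with Im z > 0 (equivalently, with the normalized derivative ′ = (2/(πi))·d/dz, one has λ′ = −2θ₂⁴λ). -/

import Mathlib

open Complex

/-- The theta constant `θ₂(z) = Σ_{n∈ℤ} exp(πiz(2n-1)²/4)`. -/
noncomputable def theta2 (z : ℂ) : ℂ :=
  ∑' n : ℤ, Complex.exp ((Real.pi : ℂ) * Complex.I * z * (2*(n : ℂ) - 1)^2 / 4)

/-- The theta constant `θ₃(z) = Σ_{n∈ℤ} exp(πizn²)`. -/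
noncomputable def theta3 (z : ℂ) : ℂ :=
  ∑' n : ℤ, Complex.exp ((Real.pi : ℂ) * Complex.I * z * (n : ℂ)^2)

/-- The theta constant `θ₀(z) = Σ_{n∈ℤ} (-1)ⁿ exp(πizn²)`. -/
noncomputable def theta0 (z : ℂ) : ℂ :=
  ∑' n : ℤ, (-1 : ℂ)^n * Complex.exp ((Real.pi : ℂ) * Complex.I * z * (n : ℂ)^2)

/-- The lambda function `λ(z) = (θ₀(z)/θ₃(z))⁴`. -/
noncomputable def lambdaFn (z : ℂ) : ℂ := (theta0 z / theta3 z)^4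

namespace ThetaSeries

open Filter Topology

/-- The exponential `exp(πizx)`. -/
noncomputable def nome (z x : ℂ) : ℂ := exp ((Real.pi : ℂ) * I * z * x)

/-- The shifted theta series `Σ_{n∈ℤ} c(n) exp(πiz(n+s)²)`. -/
noncomputable def series (c : ℤ → ℂ) (s : ℝ) (z : ℂ) : ℂ :=
  ∑' n : ℤ, c n * nome z ((n + s) ^ 2)

/-- Coefficients of at most quadratic growth. -/
def QuadBound (c : ℤ → ℂ) : Prop := ∀ n : ℤ, ‖c n‖ ≤ 2 * (1 + (n : ℝ) ^ 2)

lemma nome_mul_nome {z a b c d : ℂ} (h : a + b = 2 * (c + d)) :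
    nome z a * nome z b = nome (2 * z) c * nome (2 * z) d := by
  simp only [nome, ← Complex.exp_add]
  congr 1
  linear_combination (Real.pi : ℂ) * I * z * h

lemma norm_nome_ofReal (z : ℂ) (x : ℝ) : ‖nome z x‖ = Real.exp (-Real.pi * z.im * x) := by
  have h : (Real.pi : ℂ) * I * z * x = ((Real.pi * x : ℝ) : ℂ) * (I * z) := by
    push_cast
    ring
  rw [nome, Complex.norm_exp, h, Complex.re_ofReal_mul, Complex.I_mul_re]
  ring_nf

lemma norm_nome (z : ℂ) (n : ℤ) (s : ℝ) :
    ‖nome z ((n + s) ^ 2)‖ = Real.exp (-Real.pi * z.im * (n + s) ^ 2) := by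
  have h := norm_nome_ofReal z (((n : ℝ) + s) ^ 2)
  push_cast at h
  exact h

lemma summable_pow_mul_gaussian (k : ℕ) (s : ℝ) {y : ℝ} (hy : 0 < y) :
    Summable fun n : ℤ => |(n : ℝ)| ^ k * Real.exp (-Real.pi * y * (n + s) ^ 2) := by
  have h := summable_pow_mul_jacobiTheta₂_term_bound (|s| * y) hy k
  refine Summable.of_nonneg_of_le (fun n => by positivity) (fun n => ?_) h
  rw [Int.cast_abs]
  gcongr ?_ * Real.exp ?_
  have h1 : -(|s| * |(n : ℝ)|) ≤ s * n := by
    rw [← abs_mul]; exact neg_abs_le _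
  have h2 : y * (n : ℝ) ^ 2 - 2 * (|s| * y) * |(n : ℝ)| ≤ y * (n + s) ^ 2 := by
    nlinarith [mul_nonneg hy.le (sq_nonneg s), mul_le_mul_of_nonneg_left h1 hy.le]
  nlinarith [mul_le_mul_of_nonneg_left h2 Real.pi_pos.le]

lemma summable_quad_mul_gaussian (s : ℝ) {y : ℝ} (hy : 0 < y) :
    Summable fun n : ℤ => 2 * (1 + (n : ℝ) ^ 2) * Real.exp (-Real.pi * y * (n + s) ^ 2) := by
  refine (((summable_pow_mul_gaussian 0 s hy).add
    (summable_pow_mul_gaussian 2 s hy)).mul_left 2).congr fun n => ?_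
  rw [sq_abs]
  ring

lemma summable_norm_term {c : ℤ → ℂ} (hc : QuadBound c) (s : ℝ) {z : ℂ} (hz : 0 < z.im) :
    Summable fun n : ℤ => ‖c n * nome z ((n + s) ^ 2)‖ := by
  refine Summable.of_nonneg_of_le (fun n => by positivity) (fun n => ?_)
    (summable_quad_mul_gaussian s hz)
  rw [norm_mul, norm_nome]
  gcongr
  exact hc n

/-- `a` is the sum of the double theta series with coefficients `C` and shifts `s`, `t`. -/
def HasSeries (C : ℤ → ℤ → ℂ) (s t : ℝ) (z a : ℂ) : Prop :=
  HasSum (fun p : ℤ × ℤ => C p.1 p.2 * (nome z ((p.1 + s) ^ 2) * nome z ((p.2 + t) ^ 2))) a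

lemma HasSeries.add {C D : ℤ → ℤ → ℂ} {s t : ℝ} {z a b : ℂ} (ha : HasSeries C s t z a)
    (hb : HasSeries D s t z b) : HasSeries (fun k l => C k l + D k l) s t z (a + b) := by
  simpa only [HasSeries, add_mul] using HasSum.add ha hb

lemma HasSeries.neg {C : ℤ → ℤ → ℂ} {s t : ℝ} {z a : ℂ} (ha : HasSeries C s t z a) :
    HasSeries (fun k l => -C k l) s t z (-a) := by
  simpa only [HasSeries, neg_mul] using HasSum.neg ha

lemma HasSeries.sub {C D : ℤ → ℤ → ℂ} {s t : ℝ} {z a b : ℂ} (ha : HasSeries C s t z a)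
    (hb : HasSeries D s t z b) : HasSeries (fun k l => C k l - D k l) s t z (a - b) := by
  simpa only [HasSeries, sub_mul] using HasSum.sub ha hb

lemma hasSeries_mul {c d : ℤ → ℂ} (hc : QuadBound c) (hd : QuadBound d) (s t : ℝ) {z : ℂ}
    (hz : 0 < z.im) :
    HasSeries (fun k l => c k * d l) s t z (series c s z * series d t z) := by
  have hf := summable_norm_term hc s hz
  have hg := summable_norm_term hd t hz
  rw [series, series, tsum_mul_tsum_of_summable_norm hf hg]
  refine (summable_mul_of_summable_norm hf hg).hasSum.congr_fun fun p => ?_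
  ring

/-- Splitting a sum over pairs of integers according to whether they have the same parity. -/
lemma hasSum_of_parity {F : ℤ × ℤ → ℂ} {a b : ℂ}
    (ha : HasSum (fun p : ℤ × ℤ => F (p.1 + p.2, p.1 - p.2)) a)
    (hb : HasSum (fun p : ℤ × ℤ => F (p.1 + p.2 + 1, p.1 - p.2)) b) : HasSum F (a + b) := by
  have he : Function.Injective fun p : ℤ × ℤ => (p.1 + p.2, p.1 - p.2) := by
    rintro ⟨a, b⟩ ⟨c, d⟩ h
    simp only [Prod.mk.injEq] at h ⊢
    lia
  have ho : Function.Injective fun p : ℤ × ℤ => (p.1 + p.2 + 1, p.1 - p.2) := by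
    rintro ⟨a, b⟩ ⟨c, d⟩ h
    simp only [Prod.mk.injEq] at h ⊢
    lia
  refine (he.hasSum_range_iff.2 ha).add_isCompl ?_ (ho.hasSum_range_iff.2 hb)
  constructor
  · rw [Set.disjoint_left]
    rintro _ ⟨⟨a, b⟩, rfl⟩ ⟨⟨c, d⟩, h⟩
    simp only [Prod.mk.injEq] at h
    lia
  · refine codisjoint_iff.2 (Set.eq_univ_iff_forall.2 ?_)
    rintro ⟨n, m⟩
    rcases Int.even_or_odd' (n + m) with ⟨k, h | h⟩
    · left
      exact ⟨(k, n - k), by simp only [Prod.mk.injEq]; lia⟩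
    · right
      exact ⟨(k, n - 1 - k), by simp only [Prod.mk.injEq]; lia⟩

/-- The product of two theta series at `z` in terms of double theta series at `2z`. -/
lemma mul_eq_of_parity {c d : ℤ → ℂ} (hc : QuadBound c) (hd : QuadBound d) {s t : ℝ} {z : ℂ}
    (hz : 0 < z.im) {s₁ t₁ s₂ t₂ : ℝ} {C D : ℤ → ℤ → ℂ} {a b : ℂ}
    (ha : HasSeries C s₁ t₁ (2 * z) a) (hb : HasSeries D s₂ t₂ (2 * z) b)
    (hs₁ : s₁ = (s + t) / 2) (ht₁ : t₁ = (s - t) / 2)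
    (hs₂ : s₂ = (s + t + 1) / 2) (ht₂ : t₂ = (s - t + 1) / 2)
    (hC : ∀ k l, c (k + l) * d (k - l) = C k l)
    (hD : ∀ k l, c (k + l + 1) * d (k - l) = D k l) :
    series c s z * series d t z = a + b := by
  subst hs₁ ht₁ hs₂ ht₂
  refine (hasSeries_mul hc hd s t hz).unique (hasSum_of_parity (ha.congr_fun fun p => ?_)
    (hb.congr_fun fun p => ?_))
  · dsimp only
    rw [hC, nome_mul_nome (z := z)]
    push_cast
    ring
  · dsimp only
    rw [hD, nome_mul_nome (z := z)]
    push_cast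
    ring

lemma series_comp_add_one (c : ℤ → ℂ) (s : ℝ) (z : ℂ) :
    series (fun n => c (n + 1)) (s + 1) z = series c s z := by
  rw [series, series, ← (Equiv.addRight (1 : ℤ)).tsum_eq (fun n : ℤ => c n * nome z ((n + s) ^ 2))]
  refine tsum_congr fun n => ?_
  simp only [Equiv.coe_addRight]
  push_cast
  ring_nf

lemma series_eq_zero {c : ℤ → ℂ} {s : ℝ} (m : ℤ) (hm : (m : ℝ) = 2 * s)
    (hc : ∀ n, c (-m - n) = -c n) (z : ℂ) : series c s z = 0 := by
  have hm' : (m : ℂ) = 2 * s := by exact_mod_cast hm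
  have h : series c s z = -series c s z := by
    conv_lhs => rw [series, ← (Equiv.subLeft (-m)).tsum_eq]
    rw [series, ← tsum_neg]
    refine tsum_congr fun n => ?_
    rw [Equiv.subLeft_apply, hc]
    have : (((-m - n : ℤ) : ℂ) + s) ^ 2 = (n + s) ^ 2 := by
      push_cast
      rw [hm']
      ring
    rw [this]
    ring
  linear_combination h / 2

/-- The sign character `n ↦ (-1)ⁿ`. -/
noncomputable def sgn (n : ℤ) : ℂ := (-1) ^ n

lemma sgn_add (m n : ℤ) : sgn (m + n) = sgn m * sgn n := zpow_add₀ (by norm_num) m n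

lemma sgn_one : sgn 1 = -1 := by simp [sgn]

lemma sgn_neg (n : ℤ) : sgn (-n) = sgn n := by
  simp [sgn, ← inv_zpow]

lemma sgn_sub (m n : ℤ) : sgn (m - n) = sgn m * sgn n := by
  rw [sub_eq_add_neg, sgn_add, sgn_neg]

lemma sgn_mul_self (n : ℤ) : sgn n * sgn n = 1 := by
  rw [← sgn_sub, sub_self]; simp [sgn]

lemma norm_sgn (n : ℤ) : ‖sgn n‖ = 1 := by simp [sgn]

lemma quadBound_one : QuadBound fun _ => 1 := fun n => by
  rw [norm_one]; nlinarith [sq_nonneg (n : ℝ)]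

lemma QuadBound.sgn_mul {c : ℤ → ℂ} (hc : QuadBound c) : QuadBound fun n => sgn n * c n :=
  fun n => by rw [norm_mul, norm_sgn, one_mul]; exact hc n

lemma quadBound_sgn : QuadBound sgn := by
  simpa using quadBound_one.sgn_mul

lemma quadBound_linear {s : ℝ} (h0 : 0 ≤ s) (h1 : s ≤ 1) : QuadBound fun n => (n : ℂ) + s :=
  fun n => by
    beta_reduce
    rw [← Complex.ofReal_intCast, ← Complex.ofReal_add, Complex.norm_real, Real.norm_eq_abs,
      abs_le]
    constructor <;> nlinarith [sq_nonneg ((n : ℝ) - 1), sq_nonneg ((n : ℝ) + 1)]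

lemma quadBound_sq {s : ℝ} (h0 : 0 ≤ s) (h1 : s ≤ 1) : QuadBound fun n => ((n : ℂ) + s) ^ 2 :=
  fun n => by
    beta_reduce
    rw [← Complex.ofReal_intCast, ← Complex.ofReal_add, norm_pow, Complex.norm_real,
      Real.norm_eq_abs, sq_abs]
    nlinarith [sq_nonneg ((n : ℝ) - s)]

/-- The derivative of `θ₁` at the origin, up to normalization. -/
noncomputable def theta1' (z : ℂ) : ℂ :=
  series (fun n => sgn n * ((n : ℂ) + (1 / 2 : ℝ))) (1 / 2) z

lemma theta3_eq (z : ℂ) : theta3 z = series (fun _ => 1) 0 z := by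
  simp [theta3, series, nome]

lemma theta0_eq (z : ℂ) : theta0 z = series sgn 0 z := by
  simp [theta0, series, nome, sgn]

lemma theta2_eq (z : ℂ) : theta2 z = series (fun _ => 1) (1 / 2) z := by
  rw [theta2, series, ← (Equiv.addRight (1 : ℤ)).tsum_eq]
  refine tsum_congr fun n => ?_
  simp only [Equiv.coe_addRight, nome, one_mul]
  push_cast
  ring_nf

lemma two_mul_im_pos {z : ℂ} (hz : 0 < z.im) : 0 < (2 * z).im := by simpa using hz

lemma series_sgn_half (z : ℂ) : series sgn (1 / 2) z = 0 :=
  series_eq_zero 1 (by norm_num) (fun n => by rw [sgn_sub, sgn_neg, sgn_one]; ring) z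

lemma series_one_shift (z : ℂ) : series (fun _ => 1) 1 z = theta3 z := by
  simpa [theta3_eq] using series_comp_add_one (fun _ => 1) 0 z

lemma series_sgn_shift (z : ℂ) : series sgn 1 z = -theta0 z := by
  have h := series_comp_add_one sgn 0 z
  rw [zero_add, ← theta0_eq] at h
  rw [← h, series, series, ← tsum_neg]
  refine tsum_congr fun n => ?_
  rw [sgn_add, sgn_one]
  ring

lemma series_sq_shift (z : ℂ) :
    series (fun n => ((n : ℂ) + (1 : ℝ)) ^ 2) 1 z =
      series (fun n => ((n : ℂ) + (0 : ℝ)) ^ 2) 0 z := by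
  rw [← series_comp_add_one _ 0, zero_add]
  congr 1
  ext n
  push_cast
  ring

lemma theta3_mul_theta0 {z : ℂ} (hz : 0 < z.im) : theta3 z * theta0 z = theta0 (2 * z) ^ 2 := by
  have hz2 := two_mul_im_pos hz
  rw [theta3_eq, theta0_eq, theta0_eq, mul_eq_of_parity quadBound_one quadBound_sgn hz
    (hasSeries_mul quadBound_sgn quadBound_sgn 0 0 hz2)
    (hasSeries_mul quadBound_sgn quadBound_sgn (1 / 2) (1 / 2) hz2)
    (by ring) (by ring) (by ring) (by ring)
    (fun k l => by rw [sgn_sub]; ring) (fun k l => by rw [sgn_sub]; ring), series_sgn_half]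
  ring

lemma theta3_sq {z : ℂ} (hz : 0 < z.im) :
    theta3 z ^ 2 = theta3 (2 * z) ^ 2 + theta2 (2 * z) ^ 2 := by
  have hz2 := two_mul_im_pos hz
  rw [sq, theta3_eq, theta3_eq, theta2_eq, mul_eq_of_parity quadBound_one quadBound_one hz
    (hasSeries_mul quadBound_one quadBound_one 0 0 hz2)
    (hasSeries_mul quadBound_one quadBound_one (1 / 2) (1 / 2) hz2)
    (by ring) (by ring) (by ring) (by ring) (fun _ _ => rfl) (fun _ _ => rfl)]
  ring

lemma theta0_sq {z : ℂ} (hz : 0 < z.im) :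
    theta0 z ^ 2 = theta3 (2 * z) ^ 2 - theta2 (2 * z) ^ 2 := by
  have hz2 := two_mul_im_pos hz
  rw [sq, theta0_eq, theta3_eq, theta2_eq, mul_eq_of_parity quadBound_sgn quadBound_sgn hz
    (hasSeries_mul quadBound_one quadBound_one 0 0 hz2)
    (hasSeries_mul quadBound_one quadBound_one (1 / 2) (1 / 2) hz2).neg
    (by ring) (by ring) (by ring) (by ring) (fun k l => ?_) (fun k l => ?_)]
  · ring
  · rw [sgn_sub, sgn_add]
    linear_combination sgn l * sgn l * sgn_mul_self k + sgn_mul_self l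
  · rw [sgn_sub, sgn_add, sgn_add, sgn_one]
    linear_combination -sgn l * sgn l * sgn_mul_self k - sgn_mul_self l

lemma theta2_sq {z : ℂ} (hz : 0 < z.im) :
    theta2 z ^ 2 = 2 * theta2 (2 * z) * theta3 (2 * z) := by
  have hz2 := two_mul_im_pos hz
  rw [sq, theta2_eq, theta2_eq, mul_eq_of_parity quadBound_one quadBound_one hz
    (hasSeries_mul quadBound_one quadBound_one (1 / 2) 0 hz2)
    (hasSeries_mul quadBound_one quadBound_one 1 (1 / 2) hz2)
    (by ring) (by ring) (by ring) (by ring) (fun _ _ => rfl) (fun _ _ => rfl),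
    series_one_shift, ← theta3_eq]
  ring

lemma quadBound_sgn_half : QuadBound fun n => sgn n * ((n : ℂ) + (1 / 2 : ℝ)) :=
  (quadBound_linear (by norm_num) (by norm_num)).sgn_mul

lemma theta1'_mul_theta2 {z : ℂ} (hz : 0 < z.im) :
    theta1' z * theta2 z = 2 * theta1' (2 * z) * theta0 (2 * z) := by
  have hz2 := two_mul_im_pos hz
  have h0 := quadBound_linear le_rfl zero_le_one
  have h1 := quadBound_linear zero_le_one le_rfl
  rw [theta1', theta2_eq, mul_eq_of_parity quadBound_sgn_half quadBound_one hz
    ((hasSeries_mul quadBound_sgn_half quadBound_sgn (1 / 2) 0 hz2).add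
      (hasSeries_mul quadBound_sgn h0.sgn_mul (1 / 2) 0 hz2))
    ((hasSeries_mul quadBound_sgn quadBound_sgn_half 1 (1 / 2) hz2).add
      (hasSeries_mul h1.sgn_mul quadBound_sgn 1 (1 / 2) hz2)).neg
    (by ring) (by ring) (by ring) (by ring) (fun k l => ?_) (fun k l => ?_),
    series_sgn_half, series_sgn_shift, ← theta1', ← theta0_eq]
  · ring
  · rw [sgn_add]
    push_cast
    ring
  · rw [sgn_add, sgn_add, sgn_one]
    push_cast
    ring

lemma theta1'_sq {z : ℂ} (hz : 0 < z.im) :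
    theta1' z ^ 2 = 2 * (theta3 (2 * z) *
        series (fun n => ((n : ℂ) + (1 / 2 : ℝ)) ^ 2) (1 / 2) (2 * z)
      - theta2 (2 * z) * series (fun n => ((n : ℂ) + (0 : ℝ)) ^ 2) 0 (2 * z)) := by
  have hz2 := two_mul_im_pos hz
  have h0 : QuadBound fun n => ((n : ℂ) + (0 : ℝ)) ^ 2 := quadBound_sq le_rfl zero_le_one
  have h1 : QuadBound fun n => ((n : ℂ) + (1 : ℝ)) ^ 2 := quadBound_sq zero_le_one le_rfl
  have h2 : QuadBound fun n => ((n : ℂ) + (1 / 2 : ℝ)) ^ 2 :=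
    quadBound_sq (by norm_num) (by norm_num)
  rw [sq, theta1', mul_eq_of_parity quadBound_sgn_half quadBound_sgn_half hz
    ((hasSeries_mul h2 quadBound_one (1 / 2) 0 hz2).sub
      (hasSeries_mul quadBound_one h0 (1 / 2) 0 hz2))
    ((hasSeries_mul quadBound_one h2 1 (1 / 2) hz2).sub
      (hasSeries_mul h1 quadBound_one 1 (1 / 2) hz2))
    (by ring) (by ring) (by ring) (by ring) (fun k l => ?_) (fun k l => ?_),
    series_sq_shift, series_one_shift, ← theta2_eq, ← theta3_eq]
  · ring
  · rw [sgn_sub, sgn_add]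
    push_cast
    linear_combination ((k + l + 1 / 2 : ℂ) * (k - l + 1 / 2)) *
      (sgn l * sgn l * sgn_mul_self k + sgn_mul_self l)
  · rw [sgn_sub, sgn_add, sgn_add, sgn_one]
    push_cast
    linear_combination -((k + l + 1 + 1 / 2 : ℂ) * (k - l + 1 / 2)) *
      (sgn l * sgn l * sgn_mul_self k + sgn_mul_self l)

lemma hasDerivAt_series {c : ℤ → ℂ} (hc : ∀ n, ‖c n‖ ≤ 1) {s : ℝ} (h0 : 0 ≤ s) (h1 : s ≤ 1)
    {z : ℂ} (hz : 0 < z.im) :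
    HasDerivAt (series c s)
      ((Real.pi : ℂ) * I * series (fun n => c n * ((n : ℂ) + s) ^ 2) s z) z := by
  have hz2 : 0 < z.im / 2 := by positivity
  have hcq : QuadBound c := fun n => (hc n).trans (by nlinarith [sq_nonneg (n : ℝ)])
  have hmem : z ∈ {w : ℂ | z.im / 2 < w.im} := half_lt_self hz
  rw [series, ← tsum_mul_left]
  refine hasDerivAt_tsum_of_isPreconnected
    ((summable_quad_mul_gaussian s hz2).mul_left Real.pi)
    (isOpen_lt continuous_const continuous_im)
    (convex_halfSpace_im_gt _).isPreconnected (fun n w _ => ?_) (fun n w hw => ?_)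
    hmem (summable_norm_term hcq s hz).of_norm hmem
    (g' := fun n w => (Real.pi : ℂ) * I * (c n * ((n : ℂ) + s) ^ 2 * nome w ((n + s) ^ 2)))
  · have h : HasDerivAt (fun w => (Real.pi : ℂ) * I * w * ((n : ℂ) + s) ^ 2)
        ((Real.pi : ℂ) * I * 1 * ((n : ℂ) + s) ^ 2) w :=
      ((hasDerivAt_id w).const_mul _).mul_const _
    have hn : HasDerivAt (fun w => c n * nome w ((n + s) ^ 2))
        (c n * (nome w ((n + s) ^ 2) * ((Real.pi : ℂ) * I * 1 * ((n : ℂ) + s) ^ 2))) w :=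
      h.cexp.const_mul (c n)
    exact hn.congr_deriv (by ring)
  · have hb := quadBound_sq h0 h1 n
    have hw' : z.im / 2 ≤ w.im := le_of_lt hw
    rw [norm_mul, norm_mul, norm_mul, norm_mul, norm_nome, Complex.norm_I, mul_one,
      Complex.norm_real, Real.norm_of_nonneg Real.pi_pos.le]
    gcongr Real.pi * (?_ * Real.exp ?_)
    · calc ‖c n‖ * ‖((n : ℂ) + s) ^ 2‖ ≤ 1 * ‖((n : ℂ) + s) ^ 2‖ := by gcongr; exact hc n
        _ ≤ _ := by rw [one_mul]; exact hb
    · have := mul_le_mul_of_nonneg_right hw' (mul_nonneg Real.pi_pos.le (sq_nonneg ((n : ℝ) + s)))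
      linarith

lemma im_two_pow_mul (k : ℕ) (z : ℂ) : (2 ^ k * z).im = 2 ^ k * z.im := by
  have h : (2 : ℂ) ^ k = ((2 ^ k : ℝ) : ℂ) := by push_cast; rfl
  rw [h, Complex.im_ofReal_mul]

lemma im_two_pow_mul_pos (k : ℕ) {z : ℂ} (hz : 0 < z.im) : 0 < (2 ^ k * z).im := by
  rw [im_two_pow_mul]
  positivity

/-- The leading coefficient of a theta series along `2ᵏz`. -/
lemma tendsto_series {c : ℤ → ℂ} (hc : QuadBound c) {s : ℝ} {S : Finset ℤ}
    (hs : ∀ n : ℤ, s ^ 2 ≤ (n + s) ^ 2) (hS : ∀ n : ℤ, n ∈ S ↔ ((n : ℝ) + s) ^ 2 = s ^ 2)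
    {z : ℂ} (hz : 0 < z.im) :
    Tendsto (fun k : ℕ => nome (2 ^ k * z) (-s ^ 2) * series c s (2 ^ k * z)) atTop
      (𝓝 (∑ n ∈ S, c n)) := by
  have hterm (k : ℕ) (n : ℤ) :
      nome (2 ^ k * z) (-s ^ 2) * (c n * nome (2 ^ k * z) ((n + s) ^ 2))
        = c n * nome (2 ^ k * z) ((((n : ℝ) + s) ^ 2 - s ^ 2 : ℝ) : ℂ) := by
    rw [mul_left_comm, nome, nome, nome, ← Complex.exp_add]
    congr 2
    push_cast
    ring
  have hsum : ∑ n ∈ S, c n = ∑' n, if n ∈ S then c n else 0 := by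
    rw [tsum_eq_sum (s := S) fun n hn => if_neg hn]
    exact Finset.sum_congr rfl fun n hn => (if_pos hn).symm
  simp_rw [series, ← tsum_mul_left, hterm]
  rw [hsum]
  refine tendsto_tsum_of_dominated_convergence
    ((summable_quad_mul_gaussian s hz).mul_left (Real.exp (Real.pi * z.im * s ^ 2)))
    (fun n => ?_) (Eventually.of_forall fun k n => ?_)
  · split_ifs with hn
    · rw [(hS n).1 hn]
      simp [nome]
    · have hpos : 0 < ((n : ℝ) + s) ^ 2 - s ^ 2 :=
        sub_pos.2 (lt_of_le_of_ne (hs n) fun h => hn ((hS n).2 h.symm))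
      rw [← mul_zero (c n)]
      refine Tendsto.const_mul _ (tendsto_zero_iff_norm_tendsto_zero.2 ?_)
      simp_rw [norm_nome_ofReal, im_two_pow_mul]
      refine Real.tendsto_exp_atBot.comp ?_
      have h := (tendsto_pow_atTop_atTop_of_one_lt (one_lt_two (α := ℝ))).atTop_mul_const
        (mul_pos (mul_pos Real.pi_pos hz) hpos)
      refine (tendsto_neg_atTop_atBot.comp h).congr fun k => ?_
      simp only [Function.comp_apply]
      ring
  · rw [norm_mul, norm_nome_ofReal, im_two_pow_mul, mul_left_comm (Real.exp _), ← Real.exp_add]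
    gcongr ?_ * Real.exp ?_
    · exact hc n
    · have h1 : (1 : ℝ) ≤ 2 ^ k := one_le_pow₀ one_le_two
      have h2 := mul_le_mul_of_nonneg_right h1
        (mul_nonneg (mul_nonneg Real.pi_pos.le hz.le) (sub_nonneg.2 (hs n)))
      linarith

lemma tendsto_series_zero {c : ℤ → ℂ} (hc : QuadBound c) {z : ℂ} (hz : 0 < z.im) :
    Tendsto (fun k : ℕ => series c 0 (2 ^ k * z)) atTop (𝓝 (c 0)) := by
  have h := tendsto_series hc (s := 0) (S := {0}) (fun n => by nlinarith [sq_nonneg (n : ℝ)])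
    (fun n => by simp) hz
  simpa [nome] using h

lemma tendsto_series_half {c : ℤ → ℂ} (hc : QuadBound c) {z : ℂ} (hz : 0 < z.im) :
    Tendsto (fun k : ℕ => nome (2 ^ k * z) (-1 / 4) * series c (1 / 2) (2 ^ k * z)) atTop
      (𝓝 (c 0 + c (-1))) := by
  have hmul (n : ℤ) : ((n : ℝ) + 1 / 2) ^ 2 = (1 / 2) ^ 2 + ((n * (n + 1) : ℤ) : ℝ) := by
    push_cast
    ring
  have h := tendsto_series hc (s := 1 / 2) (S := {0, -1}) (fun n => ?_) (fun n => ?_) hz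
  · rw [Finset.sum_pair (by norm_num)] at h
    refine h.congr fun k => ?_
    congr 2
    norm_num
  · rw [hmul, le_add_iff_nonneg_right, Int.cast_nonneg_iff]
    rcases le_or_gt 0 n with hn | hn <;> nlinarith
  · rw [hmul, add_eq_left, Int.cast_eq_zero, mul_eq_zero]
    simp [add_eq_zero_iff_eq_neg]

lemma tendsto_theta0 {z : ℂ} (hz : 0 < z.im) :
    Tendsto (fun k : ℕ => theta0 (2 ^ k * z)) atTop (𝓝 1) := by
  simpa [theta0_eq, sgn] using tendsto_series_zero quadBound_sgn hz

lemma tendsto_theta3 {z : ℂ} (hz : 0 < z.im) :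
    Tendsto (fun k : ℕ => theta3 (2 ^ k * z)) atTop (𝓝 1) := by
  simpa [theta3_eq] using tendsto_series_zero quadBound_one hz

lemma tendsto_theta2 {z : ℂ} (hz : 0 < z.im) :
    Tendsto (fun k : ℕ => nome (2 ^ k * z) (-1 / 4) * theta2 (2 ^ k * z)) atTop (𝓝 2) := by
  simpa only [theta2_eq, one_add_one_eq_two] using tendsto_series_half quadBound_one hz

lemma tendsto_theta1' {z : ℂ} (hz : 0 < z.im) :
    Tendsto (fun k : ℕ => nome (2 ^ k * z) (-1 / 4) * theta1' (2 ^ k * z)) atTop (𝓝 1) := by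
  have h := tendsto_series_half quadBound_sgn_half hz
  have h1 : sgn 0 * (((0 : ℤ) : ℂ) + (1 / 2 : ℝ)) +
      sgn (-1) * (((-1 : ℤ) : ℂ) + (1 / 2 : ℝ)) = 1 := by
    rw [sgn_neg, sgn_one]
    norm_num [sgn]
  rwa [h1] at h

/-- A property of points of the upper half-plane that is stable under doubling holds along the
whole orbit. -/
lemma two_pow_mul_induction {P : ℂ → Prop} (h : ∀ w : ℂ, 0 < w.im → P w → P (2 * w)) {z : ℂ}
    (hz : 0 < z.im) (hP : P z) (k : ℕ) : P (2 ^ k * z) := by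
  induction k with
  | zero => simpa using hP
  | succ k ih =>
    rw [pow_succ', mul_assoc]
    exact h _ (im_two_pow_mul_pos k hz) ih

lemma theta0_ne_zero {z : ℂ} (hz : 0 < z.im) : theta0 z ≠ 0 := fun h => by
  have h0 := two_pow_mul_induction (P := fun w => theta0 w = 0) (fun w hw h => by
    rw [← sq_eq_zero_iff, ← theta3_mul_theta0 hw, h, mul_zero]) hz h
  have hlim := tendsto_theta0 hz
  simp_rw [h0] at hlim
  exact zero_ne_one (tendsto_nhds_unique tendsto_const_nhds hlim)

lemma theta3_ne_zero {z : ℂ} (hz : 0 < z.im) : theta3 z ≠ 0 := fun h => by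
  have h2 := theta3_mul_theta0 hz
  rw [h, zero_mul] at h2
  exact theta0_ne_zero (two_mul_im_pos hz) (sq_eq_zero_iff.1 h2.symm)

lemma theta2_ne_zero {z : ℂ} (hz : 0 < z.im) : theta2 z ≠ 0 := fun h => by
  have h0 := two_pow_mul_induction (P := fun w => theta2 w = 0) (fun w hw h => by
    have h2 := theta2_sq hw
    simpa [h, theta3_ne_zero (two_mul_im_pos hw)] using h2) hz h
  have hlim := tendsto_theta2 hz
  simp_rw [h0, mul_zero] at hlim
  exact two_ne_zero (tendsto_nhds_unique hlim tendsto_const_nhds)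

/-- Jacobi's derivative formula. -/
lemma theta1'_eq {z : ℂ} (hz : 0 < z.im) :
    theta1' z = theta2 z * theta3 z * theta0 z / 2 := by
  set r : ℂ → ℂ := fun w => theta1' w / (theta2 w * theta3 w * theta0 w) with hr
  have hinv (w : ℂ) (hw : 0 < w.im) (h : r w = r z) : r (2 * w) = r z := by
    have hw2 := two_mul_im_pos hw
    have a2 := theta2_ne_zero hw
    have a3 := theta3_ne_zero hw
    have a0 := theta0_ne_zero hw
    have b2 := theta2_ne_zero hw2
    have b3 := theta3_ne_zero hw2
    have b0 := theta0_ne_zero hw2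
    rw [← h, hr]
    dsimp only
    rw [div_eq_div_iff (by positivity) (by positivity)]
    refine mul_right_cancel₀ (mul_ne_zero two_ne_zero b0) ?_
    linear_combination (-(theta2 w * theta3 w * theta0 w)) * theta1'_mul_theta2 hw
      + theta1' w * theta3 w * theta0 w * theta2_sq hw
      + 2 * theta1' w * theta2 (2 * w) * theta3 (2 * w) * theta3_mul_theta0 hw
  have hconst := two_pow_mul_induction (P := fun w => r w = r z) hinv hz rfl
  have hlim : Tendsto (fun k : ℕ => r (2 ^ k * z)) atTop (𝓝 (1 / (2 * 1 * 1))) := by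
    refine ((tendsto_theta1' hz).div (((tendsto_theta2 hz).mul (tendsto_theta3 hz)).mul
      (tendsto_theta0 hz)) (by norm_num)).congr fun k => ?_
    rw [Pi.div_apply, mul_assoc (nome _ _), mul_assoc (nome _ _),
      mul_div_mul_left _ _ (show nome _ _ ≠ 0 from Complex.exp_ne_zero _)]
  simp_rw [hconst] at hlim
  have h := tendsto_nhds_unique tendsto_const_nhds hlim
  have hne : theta2 z * theta3 z * theta0 z ≠ 0 :=
    mul_ne_zero (mul_ne_zero (theta2_ne_zero hz) (theta3_ne_zero hz)) (theta0_ne_zero hz)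
  rw [hr] at h
  dsimp only at h
  rw [div_eq_iff hne] at h
  rw [h]
  ring

lemma hasDerivAt_theta3 {z : ℂ} (hz : 0 < z.im) :
    HasDerivAt theta3
      ((Real.pi : ℂ) * I * series (fun n => ((n : ℂ) + (0 : ℝ)) ^ 2) 0 z) z := by
  have h := hasDerivAt_series (c := fun _ => 1) (by simp) le_rfl zero_le_one hz
  rw [← funext theta3_eq] at h
  simpa only [one_mul] using h

lemma hasDerivAt_theta2 {z : ℂ} (hz : 0 < z.im) :
    HasDerivAt theta2
      ((Real.pi : ℂ) * I * series (fun n => ((n : ℂ) + (1 / 2 : ℝ)) ^ 2) (1 / 2) z) z := by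
  have h := hasDerivAt_series (c := fun _ => 1) (s := 1 / 2) (by simp) (by norm_num)
    (by norm_num) hz
  rw [← funext theta2_eq] at h
  simpa only [one_mul] using h

lemma differentiableAt_theta0 {z : ℂ} (hz : 0 < z.im) : DifferentiableAt ℂ theta0 z := by
  have h := hasDerivAt_series (c := sgn) (fun n => (norm_sgn n).le) le_rfl zero_le_one hz
  rw [← funext theta0_eq] at h
  exact h.differentiableAt

/-- The Wronskian of `θ₀` and `θ₃`. -/
lemma wronskian_theta0_theta3 {z : ℂ} (hz : 0 < z.im) :
    4 * (deriv theta3 z * theta0 z - deriv theta0 z * theta3 z)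
      = (Real.pi : ℂ) * I * theta2 z ^ 4 * theta3 z * theta0 z := by
  have hz2 := two_mul_im_pos hz
  have hmem : {w : ℂ | 0 < w.im} ∈ 𝓝 z := (isOpen_lt continuous_const continuous_im).mem_nhds hz
  have hmul : HasDerivAt (fun w : ℂ => 2 * w) 2 z := by
    simpa using (hasDerivAt_id z).const_mul (2 : ℂ)
  have h3 := (hasDerivAt_theta3 hz2).comp z hmul
  have h2 := (hasDerivAt_theta2 hz2).comp z hmul
  have e3 := (((hasDerivAt_theta3 hz).differentiableAt.hasDerivAt.pow 2).congr_of_eventuallyEq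
    (f₁ := fun w => theta3 (2 * w) ^ 2 + theta2 (2 * w) ^ 2)
    (by filter_upwards [hmem] with w hw using (theta3_sq hw).symm)).unique
    ((h3.pow 2).add (h2.pow 2))
  have e0 := (((differentiableAt_theta0 hz).hasDerivAt.pow 2).congr_of_eventuallyEq
    (f₁ := fun w => theta3 (2 * w) ^ 2 - theta2 (2 * w) ^ 2)
    (by filter_upwards [hmem] with w hw using (theta0_sq hw).symm)).unique
    ((h3.pow 2).sub (h2.pow 2))
  have hj := theta1'_sq hz
  rw [theta1'_eq hz] at hj
  have s3 := theta3_sq hz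
  have s0 := theta0_sq hz
  have s2 := theta2_sq hz
  simp only [Function.comp_apply, Nat.cast_ofNat, Nat.add_one_sub_one, pow_one] at e3 e0
  set A := theta3 (2 * z)
  set B := theta2 (2 * z)
  set A₁ := series (fun n => ((n : ℂ) + (0 : ℝ)) ^ 2) 0 (2 * z)
  set B₁ := series (fun n => ((n : ℂ) + (1 / 2 : ℝ)) ^ 2) (1 / 2) (2 * z)
  refine mul_right_cancel₀ (mul_ne_zero (theta3_ne_zero hz) (theta0_ne_zero hz)) ?_
  linear_combination 2 * theta0 z ^ 2 * e3 - 2 * theta3 z ^ 2 * e0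
    + (Real.pi : ℂ) * I * (8 * (A * A₁ + B * B₁) * s0 - 8 * (A * A₁ - B * B₁) * s3
      - 8 * A * B * hj - theta2 z ^ 2 * theta3 z ^ 2 * theta0 z ^ 2 * s2)

end ThetaSeries

/-- The lambda function is complex differentiable on the
upper half-plane with `dλ/dz = -πi·θ₂⁴·λ` there (equivalently, with the
normalized derivative `' = (2/(πi))d/dz`, `λ' = -2θ₂⁴λ`). -/
theorem hyperbolic_schwarz_stmt19 (z : ℂ) (hz : 0 < z.im) :
    HasDerivAt lambdaFn (-(Real.pi : ℂ) * Complex.I * (theta2 z)^4 * lambdaFn z) z := by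
  have h3 := (ThetaSeries.hasDerivAt_theta3 hz).differentiableAt.hasDerivAt
  have h0 := (ThetaSeries.differentiableAt_theta0 hz).hasDerivAt
  have hne := ThetaSeries.theta3_ne_zero hz
  refine ((h0.div h3 hne).pow 4).congr_deriv ?_
  have hne0 := ThetaSeries.theta0_ne_zero hz
  simp only [lambdaFn, Pi.div_apply, Nat.cast_ofNat, Nat.add_one_sub_one]
  field_simp
  linear_combination -ThetaSeries.wronskian_theta0_theta3 hz
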